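/- Let T ≥ 3, λ > 0, G > 0, α ∈ (0, 1], let each f_t : ℝ^d → ℝ be λ-strongly convex and differentiable with ‖∇f_t(w)‖ ≤ G for all w ∈ 𝒟, let w_1 ∈ 𝒟, set the switching budget S = (2G/λ)·log(T^α + 1) and c = T^{1−α} − 1, and define iterates by w_{t+1} = Π(w_t − η_t·∇f_t(w_t)) with step sizes η_t = 1/(λ(t + c)). Then the continuous switching constraint Σ_{t=2}^T ‖w_t − w_{t−1}‖ ≤ S holds, and the regret satisfies R = Σ_{t=1}^T f_t(w_t) − min_{w ∈ 𝒟} Σ_{t=1}^T f_t(w) ≤ λ·D²·T^{1−α} + (2G²/λ)·log(T^α + 1). -/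

import Mathlib

open scoped InnerProductSpace BigOperators

/-- Euclidean projection onto the ball `{w : ‖w‖ ≤ D/2}` in `ℝ^d`. -/
noncomputable def ballProj (d : ℕ) (D : ℝ) (p : EuclideanSpace ℝ (Fin d)) :
    EuclideanSpace ℝ (Fin d) :=
  if ‖p‖ ≤ D / 2 then p else (D / (2 * ‖p‖)) • p

theorem norm_ballProj_le (d : ℕ) {D : ℝ} (hD : 0 < D) (p : EuclideanSpace ℝ (Fin d)) :
    ‖ballProj d D p‖ ≤ D / 2 := by
  unfold ballProj
  split_ifs with h
  · exact h
  · have hp : 0 < ‖p‖ := by linarith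
    rw [norm_smul, Real.norm_of_nonneg (by positivity)]
    apply le_of_eq
    field_simp

theorem norm_ballProj_sub_le (d : ℕ) {D : ℝ} (hD : 0 < D) (p v : EuclideanSpace ℝ (Fin d))
    (hv : ‖v‖ ≤ D / 2) : ‖ballProj d D p - v‖ ≤ ‖p - v‖ := by
  unfold ballProj
  split_ifs with h
  · exact le_rfl
  · have hp : 0 < ‖p‖ := by linarith
    obtain ⟨k, hk⟩ : ∃ k, k = D / (2 * ‖p‖) := ⟨_, rfl⟩
    have hkn : k * ‖p‖ = D / 2 := by rw [hk]; field_simp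
    have hk1 : k ≤ 1 := by
      rw [hk, div_le_one (by positivity)]
      linarith
    have hinner : ⟪p, v⟫_ℝ ≤ ‖p‖ * (D / 2) :=
      (real_inner_le_norm p v).trans (by gcongr)
    rw [← hk]
    refine le_of_sq_le_sq ?_ (norm_nonneg _)
    rw [norm_sub_sq_real, norm_sub_sq_real, real_inner_smul_left, norm_smul, Real.norm_eq_abs,
      mul_pow, sq_abs, ← mul_pow, hkn]
    have h1 : (1 - k) * ⟪p, v⟫_ℝ ≤ (1 - k) * (‖p‖ * (D / 2)) :=
      mul_le_mul_of_nonneg_left hinner (by linarith)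
    have h2 : k * (‖p‖ * (D / 2)) = (D / 2) ^ 2 := by rw [← mul_assoc, hkn]; ring
    nlinarith [sq_nonneg (‖p‖ - D / 2)]

theorem norm_ballProj_gradient_step_sub_le (d : ℕ) {D G η : ℝ} (hD : 0 < D) (hη : 0 ≤ η)
    (x g : EuclideanSpace ℝ (Fin d)) (hx : ‖x‖ ≤ D / 2) (hg : ‖g‖ ≤ G) :
    ‖ballProj d D (x - η • g) - x‖ ≤ η * G := by
  refine (norm_ballProj_sub_le d hD _ x hx).trans ?_
  rw [sub_sub_cancel_left, norm_neg, norm_smul, Real.norm_of_nonneg hη]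
  gcongr

/-- One step of projected gradient descent with step size `1 / (lam * s)` on a `lam`-strongly
convex function. -/
theorem strongConvex_gradient_step (d : ℕ) {D G lam s a b : ℝ} (hD : 0 < D) (hlam : 0 < lam)
    (hs : 0 < s) (x g v : EuclideanSpace ℝ (Fin d)) (hv : ‖v‖ ≤ D / 2) (hg : ‖g‖ ≤ G)
    (hsc : a + ⟪g, v - x⟫_ℝ + lam / 2 * ‖v - x‖ ^ 2 ≤ b) :
    a - b + lam / 2 * s * ‖ballProj d D (x - (1 / (lam * s)) • g) - v‖ ^ 2 ≤
      lam / 2 * (s - 1) * ‖x - v‖ ^ 2 + G ^ 2 / (2 * lam) * (1 / s) := by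
  obtain ⟨η, hη⟩ : ∃ η, η = 1 / (lam * s) := ⟨_, rfl⟩
  have hproj := pow_le_pow_left₀ (norm_nonneg _) (norm_ballProj_sub_le d hD (x - η • g) v hv) 2
  have hexp : ‖x - η • g - v‖ ^ 2 = ‖x - v‖ ^ 2 + 2 * η * ⟪g, v - x⟫_ℝ + η ^ 2 * ‖g‖ ^ 2 := by
    rw [show x - η • g - v = (x - v) - η • g by abel, norm_sub_sq_real, real_inner_smul_right,
      norm_smul, mul_pow, Real.norm_eq_abs, sq_abs, real_inner_comm, ← neg_sub v x,
      inner_neg_right]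
    ring
  have hg2 : ‖g‖ ^ 2 ≤ G ^ 2 := pow_le_pow_left₀ (norm_nonneg _) hg 2
  have hbound : ‖ballProj d D (x - η • g) - v‖ ^ 2 ≤
      ‖x - v‖ ^ 2 + 2 * η * ⟪g, v - x⟫_ℝ + η ^ 2 * G ^ 2 := by
    rw [hexp] at hproj
    nlinarith [mul_le_mul_of_nonneg_left hg2 (sq_nonneg η)]
  have hmul := mul_le_mul_of_nonneg_left hbound (show 0 ≤ lam / 2 * s by positivity)
  have h1 : lam / 2 * s * (‖x - v‖ ^ 2 + 2 * η * ⟪g, v - x⟫_ℝ + η ^ 2 * G ^ 2) =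
      lam / 2 * s * ‖x - v‖ ^ 2 + ⟪g, v - x⟫_ℝ + G ^ 2 / (2 * lam) * (1 / s) := by
    rw [hη]
    field_simp
  rw [h1] at hmul
  rw [norm_sub_rev v x] at hsc
  rw [← hη]
  linarith

theorem sum_one_div_add_le_log {c : ℝ} (hc : 0 ≤ c) (n : ℕ) (hn : 1 ≤ n) :
    ∑ t ∈ Finset.Icc 1 n, 1 / ((t : ℝ) + c) ≤
      1 / (1 + c) + Real.log (((n : ℝ) + c) / (1 + c)) := by
  induction n, hn using Nat.le_induction with
  | base =>
    have : (1 : ℝ) + c ≠ 0 := by positivity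
    simp [this]
  | succ n hn ih =>
    have hn0 : (0 : ℝ) < n := by exact_mod_cast hn
    rw [Finset.sum_Icc_succ_top (by omega)]
    push_cast
    have h1 := Real.one_sub_inv_le_log_of_pos
      (show 0 < ((n : ℝ) + 1 + c) / ((n : ℝ) + c) by positivity)
    have h2 : 1 - (((n : ℝ) + 1 + c) / ((n : ℝ) + c))⁻¹ = 1 / ((n : ℝ) + 1 + c) := by
      field_simp
      ring
    have h3 : Real.log (((n : ℝ) + 1 + c) / (1 + c)) =
        Real.log (((n : ℝ) + c) / (1 + c)) + Real.log (((n : ℝ) + 1 + c) / ((n : ℝ) + c)) := by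
      rw [← Real.log_mul (by positivity) (by positivity)]
      congr 1
      field_simp
    rw [h2] at h1
    rw [h3]
    linarith

theorem div_le_log_add_one {x y : ℝ} (hx : 0 ≤ x) (hxy : x ≤ y) (hy : 3 ≤ y) :
    x / y ≤ Real.log (x + 1) := by
  rcases le_total x 2 with h | h
  · have h1 := Real.one_sub_inv_le_log_of_pos (show 0 < x + 1 by positivity)
    have h2 : 1 - (x + 1)⁻¹ = x / (x + 1) := by
      field_simp
      ring
    rw [h2] at h1
    refine le_trans ?_ h1
    gcongr
    linarith
  · have h1 : x / y ≤ 1 := (div_le_one (by linarith)).2 hxy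
    refine h1.trans ?_
    rw [Real.le_log_iff_exp_le (by positivity)]
    linarith [Real.exp_one_lt_d9]

theorem sum_one_div_add_rpow_le (T : ℕ) (hT : 3 ≤ T) {α : ℝ} (hα1 : α ≤ 1) :
    ∑ t ∈ Finset.Icc 1 T, 1 / ((t : ℝ) + ((T : ℝ) ^ (1 - α) - 1)) ≤
      2 * Real.log ((T : ℝ) ^ α + 1) := by
  have hT3 : (3 : ℝ) ≤ T := by exact_mod_cast hT
  have hA : 1 ≤ (T : ℝ) ^ (1 - α) := Real.one_le_rpow (by linarith) (by linarith)
  have hx : 0 < (T : ℝ) ^ α := Real.rpow_pos_of_pos (by linarith) _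
  have hxT : (T : ℝ) ^ α ≤ T := by
    simpa using Real.rpow_le_rpow_of_exponent_le (by linarith : (1 : ℝ) ≤ T) hα1
  have hmul : (T : ℝ) ^ α * (T : ℝ) ^ (1 - α) = T := by
    rw [← Real.rpow_add (by linarith)]
    simp
  have hsum := sum_one_div_add_le_log (sub_nonneg.2 hA) T (by omega)
  rw [add_sub_cancel] at hsum
  have h1 : 1 / (T : ℝ) ^ (1 - α) = (T : ℝ) ^ α / T := by
    rw [div_eq_div_iff (by positivity) (by positivity), one_mul, hmul]
  have h2 : Real.log (((T : ℝ) + ((T : ℝ) ^ (1 - α) - 1)) / (T : ℝ) ^ (1 - α)) ≤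
      Real.log ((T : ℝ) ^ α + 1) := by
    apply Real.log_le_log
    · apply div_pos <;> linarith
    · rw [div_le_iff₀ (by linarith), add_mul, hmul]
      linarith
  have h3 := div_le_log_add_one hx.le hxT hT3
  rw [h1] at hsum
  linarith

/-- For `λ`-strongly convex differentiable losses with gradients bounded by `G`
on the ball `𝒟` and `α ∈ (0, 1]`, with budget `S = (2G/λ)·log (T^α + 1)` and
`c = T^{1−α} − 1`, OGD with step sizes `η_t = 1/(λ(t + c))` satisfies the continuous switching
constraint and has regret at most `λ·D²·T^{1−α} + (2G²/λ)·log (T^α + 1)`. -/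
theorem stmt18 (d T : ℕ) (hT : 3 ≤ T) (D G lam α S c : ℝ) (hD : 0 < D) (hlam : 0 < lam)
    (hG : 0 < G) (hα0 : 0 < α) (hα1 : α ≤ 1)
    (hSdef : S = (2 * G / lam) * Real.log ((T : ℝ) ^ α + 1))
    (hcdef : c = (T : ℝ) ^ (1 - α) - 1)
    (f : ℕ → EuclideanSpace ℝ (Fin d) → ℝ)
    (hdiff : ∀ t ∈ Finset.Icc 1 T, Differentiable ℝ (f t))
    (hsc : ∀ t ∈ Finset.Icc 1 T,
      ∀ u ∈ Metric.closedBall (0 : EuclideanSpace ℝ (Fin d)) (D / 2),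
      ∀ v ∈ Metric.closedBall (0 : EuclideanSpace ℝ (Fin d)) (D / 2),
        f t v + ⟪gradient (f t) v, u - v⟫_ℝ + lam / 2 * ‖u - v‖ ^ 2 ≤ f t u)
    (hgrad : ∀ t ∈ Finset.Icc 1 T,
      ∀ v ∈ Metric.closedBall (0 : EuclideanSpace ℝ (Fin d)) (D / 2), ‖gradient (f t) v‖ ≤ G)
    (w : ℕ → EuclideanSpace ℝ (Fin d))
    (hw1 : w 1 ∈ Metric.closedBall (0 : EuclideanSpace ℝ (Fin d)) (D / 2))
    (hupd : ∀ t ∈ Finset.Icc 1 (T - 1),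
      w (t + 1) = ballProj d D (w t - (1 / (lam * ((t : ℝ) + c))) • gradient (f t) (w t))) :
    (∑ t ∈ Finset.Icc 2 T, ‖w t - w (t - 1)‖ ≤ S) ∧
    (∑ t ∈ Finset.Icc 1 T, f t (w t)) -
        (⨅ v : Metric.closedBall (0 : EuclideanSpace ℝ (Fin d)) (D / 2),
          ∑ t ∈ Finset.Icc 1 T, f t (v : EuclideanSpace ℝ (Fin d))) ≤
      lam * D ^ 2 * (T : ℝ) ^ (1 - α) + (2 * G ^ 2 / lam) * Real.log ((T : ℝ) ^ α + 1) := by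
  have hT3 : (3 : ℝ) ≤ T := by exact_mod_cast hT
  have hA : 1 ≤ (T : ℝ) ^ (1 - α) := Real.one_le_rpow (by linarith) (by linarith)
  have hc : 0 ≤ c := by linarith
  have hpos : ∀ t : ℕ, 1 ≤ t → 0 < (t : ℝ) + c := fun t ht => by
    have : (1 : ℝ) ≤ t := by exact_mod_cast ht
    linarith
  have hsum : ∑ t ∈ Finset.Icc 1 T, 1 / ((t : ℝ) + c) ≤ 2 * Real.log ((T : ℝ) ^ α + 1) := by
    rw [hcdef]
    exact sum_one_div_add_rpow_le T hT hα1
  simp only [mem_closedBall_zero_iff] at hsc hgrad hw1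
  have hw : ∀ t, 1 ≤ t → t ≤ T → ‖w t‖ ≤ D / 2 := by
    intro t ht htT
    induction t, ht using Nat.le_induction with
    | base => exact hw1
    | succ n hn _ =>
      rw [hupd n (Finset.mem_Icc.2 ⟨hn, by omega⟩)]
      exact norm_ballProj_le d hD _
  obtain ⟨N, rfl⟩ : ∃ N, T = N + 1 := ⟨T - 1, by omega⟩
  rw [Nat.add_sub_cancel] at hupd
  constructor
  · have hreindex : ∑ t ∈ Finset.Icc 2 (N + 1), ‖w t - w (t - 1)‖ =
        ∑ t ∈ Finset.Icc 1 N, ‖w (t + 1) - w t‖ := by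
      rw [← Finset.map_add_right_Icc 1 N 1, Finset.sum_map]
      simp
    rw [hreindex, hSdef]
    calc ∑ t ∈ Finset.Icc 1 N, ‖w (t + 1) - w t‖
        ≤ ∑ t ∈ Finset.Icc 1 N, G / lam * (1 / ((t : ℝ) + c)) := by
          refine Finset.sum_le_sum fun t ht => ?_
          have ht' := Finset.mem_Icc.1 ht
          have hp := hpos t ht'.1
          have hwt := hw t ht'.1 (by omega)
          rw [hupd t ht]
          refine (norm_ballProj_gradient_step_sub_le d hD (by positivity) _ _ hwt
            (hgrad t (Finset.mem_Icc.2 ⟨ht'.1, by omega⟩) _ hwt)).trans (le_of_eq ?_)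
          field_simp
      _ ≤ ∑ t ∈ Finset.Icc 1 (N + 1), G / lam * (1 / ((t : ℝ) + c)) := by
          refine Finset.sum_le_sum_of_subset_of_nonneg
            (Finset.Icc_subset_Icc le_rfl (Nat.le_succ N)) fun t ht _ => ?_
          have hp := hpos t (Finset.mem_Icc.1 ht).1
          positivity
      _ = G / lam * ∑ t ∈ Finset.Icc 1 (N + 1), 1 / ((t : ℝ) + c) := by rw [Finset.mul_sum]
      _ ≤ G / lam * (2 * Real.log (((N + 1 : ℕ) : ℝ) ^ α + 1)) := by gcongr
      _ = 2 * G / lam * Real.log (((N + 1 : ℕ) : ℝ) ^ α + 1) := by ring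
  · have hne : Nonempty (Metric.closedBall (0 : EuclideanSpace ℝ (Fin d)) (D / 2)) :=
      ⟨⟨0, Metric.mem_closedBall_self (by positivity)⟩⟩
    rw [sub_le_comm]
    refine le_ciInf fun ⟨v, hv⟩ => ?_
    rw [mem_closedBall_zero_iff] at hv
    change _ ≤ ∑ t ∈ Finset.Icc 1 (N + 1), f t v
    have hstep : ∀ t, 1 ≤ t → t ≤ N + 1 →
        f t (w t) - f t v + lam / 2 * ((t : ℝ) + c) * ‖ballProj d D
          (w t - (1 / (lam * ((t : ℝ) + c))) • gradient (f t) (w t)) - v‖ ^ 2 ≤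
        lam / 2 * ((t : ℝ) + c - 1) * ‖w t - v‖ ^ 2 + G ^ 2 / (2 * lam) * (1 / ((t : ℝ) + c)) := by
      intro t h1 h2
      have hmem := Finset.mem_Icc.2 ⟨h1, h2⟩
      exact strongConvex_gradient_step d hD hlam (hpos t h1) _ _ v hv
        (hgrad t hmem _ (hw t h1 h2)) (hsc t hmem v hv _ (hw t h1 h2))
    have hpotential : ∀ n, n ≤ N →
        ∑ t ∈ Finset.Icc 1 n, (f t (w t) - f t v) + lam / 2 * (n + c) * ‖w (n + 1) - v‖ ^ 2 ≤
          lam / 2 * c * ‖w 1 - v‖ ^ 2 +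
            G ^ 2 / (2 * lam) * ∑ t ∈ Finset.Icc 1 n, 1 / ((t : ℝ) + c) := by
      intro n hn
      induction n with
      | zero => simp
      | succ n ih =>
        have h1 := ih (by omega)
        have h2 := hstep (n + 1) (by omega) (by omega)
        rw [← hupd (n + 1) (Finset.mem_Icc.2 ⟨by omega, hn⟩)] at h2
        rw [Finset.sum_Icc_succ_top (by omega), Finset.sum_Icc_succ_top (by omega)]
        push_cast at h2 ⊢
        rw [show (n : ℝ) + 1 + c - 1 = n + c by ring] at h2
        linarith
    have h1 := hpotential N le_rfl
    have h2 := hstep (N + 1) (by omega) le_rfl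
    have h3 : 0 ≤ lam / 2 * (((N + 1 : ℕ) : ℝ) + c) * ‖ballProj d D (w (N + 1) -
        (1 / (lam * (((N + 1 : ℕ) : ℝ) + c))) • gradient (f (N + 1)) (w (N + 1))) - v‖ ^ 2 := by
      positivity
    have hregret : ∑ t ∈ Finset.Icc 1 (N + 1), (f t (w t) - f t v) ≤
        lam / 2 * c * ‖w 1 - v‖ ^ 2 +
          G ^ 2 / (2 * lam) * ∑ t ∈ Finset.Icc 1 (N + 1), 1 / ((t : ℝ) + c) := by
      rw [Finset.sum_Icc_succ_top (by omega), Finset.sum_Icc_succ_top (by omega)]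
      rw [show ((N + 1 : ℕ) : ℝ) + c - 1 = N + c by push_cast; ring] at h2
      linarith
    rw [Finset.sum_sub_distrib] at hregret
    have hdiam : ‖w 1 - v‖ ≤ D := (norm_sub_le _ _).trans (by linarith)
    have hlog : 0 ≤ Real.log (((N + 1 : ℕ) : ℝ) ^ α + 1) :=
      Real.log_nonneg (le_add_of_nonneg_left (by positivity))
    have h4 : lam / 2 * c * ‖w 1 - v‖ ^ 2 ≤ lam * D ^ 2 * ((N + 1 : ℕ) : ℝ) ^ (1 - α) := by
      calc lam / 2 * c * ‖w 1 - v‖ ^ 2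
          ≤ lam * ((N + 1 : ℕ) : ℝ) ^ (1 - α) * D ^ 2 := by
            gcongr <;> linarith
        _ = _ := by ring
    have h5 : G ^ 2 / (2 * lam) * ∑ t ∈ Finset.Icc 1 (N + 1), 1 / ((t : ℝ) + c) ≤
        2 * G ^ 2 / lam * Real.log (((N + 1 : ℕ) : ℝ) ^ α + 1) := by
      calc _ ≤ G ^ 2 / (2 * lam) * (2 * Real.log (((N + 1 : ℕ) : ℝ) ^ α + 1)) := by gcongr
        _ = G ^ 2 / lam * Real.log (((N + 1 : ℕ) : ℝ) ^ α + 1) := by field_simp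
        _ ≤ _ := by
          gcongr
          linarith [sq_nonneg G]
    linarith
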